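/- arXiv:1405.7728 — 4 statements merged into one kernel-verified Lean document; each statement's English description precedes it below -/
import Mathlib

section
/- Let B be a positively stable real d×d matrix. Then the Lyapunov equation has at most one solution: if X and Y are real d×d matrices with B·X + X·Bᵀ = B·Y + Y·Bᵀ, then X = Y. In particular, for any real d×d matrix V, the equation B·Γ + Γ·Bᵀ = V has a unique solution Γ. -/
open Matrix
open scoped Matrix

/-- A real square matrix is positively stable if every complex root of its
characteristic polynomial has positive real part. -/
def Matrix.PosStable {d : ℕ} (B : Matrix (Fin d) (Fin d) ℝ) : Prop :=
  ∀ z : ℂ, (B.charpoly.map (algebraMap ℝ ℂ)).IsRoot z → 0 < z.re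

/-- If `a` intertwines `x` and `y`, then it intertwines `p(x)` and `p(y)` for every polynomial
`p`. -/
theorem SemiconjBy.polynomial_aeval {R A : Type*} [CommSemiring R] [Semiring A] [Algebra R A]
    {a x y : A} (h : SemiconjBy a x y) (p : Polynomial R) :
    SemiconjBy a (Polynomial.aeval x p) (Polynomial.aeval y p) := by
  induction p using Polynomial.induction_on' with
  | add p q hp hq => simpa only [map_add] using hp.add_right hq
  | monomial n r =>
    simp only [Polynomial.aeval_monomial]
    exact SemiconjBy.mul_right (Algebra.commute_algebraMap_right r a) (h.pow_right n)

/-- Matrices with coprime annihilating polynomials are intertwined only by `0`. -/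
theorem SemiconjBy.eq_zero_of_isCoprime {R A : Type*} [CommRing R] [Ring A] [Algebra R A]
    {a x y : A} (h : SemiconjBy a x y) {p q : Polynomial R} (hpq : IsCoprime p q)
    (hx : Polynomial.aeval x q = 0) (hy : Polynomial.aeval y p = 0) : a = 0 := by
  obtain ⟨u, v, huv⟩ := hpq
  have hone : Polynomial.aeval x p * Polynomial.aeval x u = 1 := by
    have := congrArg (Polynomial.aeval x) huv
    rw [mul_comm u p] at this
    simpa [hx] using this
  have hzero : a * Polynomial.aeval x p = 0 := by
    simpa [hy] using (h.polynomial_aeval p).eq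
  rw [← mul_one a, ← hone, ← mul_assoc, hzero, zero_mul]

theorem Matrix.PosStable.isCoprime_charpoly {d : ℕ} {B : Matrix (Fin d) (Fin d) ℝ}
    (hB : B.PosStable) : IsCoprime B.charpoly (B.charpoly.comp (-Polynomial.X)) := by
  rw [Polynomial.isCoprime_iff_aeval_ne_zero_of_isAlgClosed ℝ ℂ]
  intro z
  by_contra! hz
  obtain ⟨h₁, h₂⟩ := hz
  have pos : 0 < z.re := hB z (by
    rwa [Polynomial.IsRoot, Polynomial.eval_map_algebraMap])
  have neg : 0 < (-z).re := hB (-z) (by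
    rw [Polynomial.IsRoot, Polynomial.eval_map_algebraMap]
    simpa [Polynomial.aeval_comp] using h₂)
  rw [Complex.neg_re] at neg
  linarith

theorem Matrix.PosStable.eq_zero_of_lyapunov {d : ℕ} {B Z : Matrix (Fin d) (Fin d) ℝ}
    (hB : B.PosStable) (hZ : B * Z + Z * Bᵀ = 0) : Z = 0 := by
  have h : SemiconjBy Z (-Bᵀ) B := by
    rw [SemiconjBy, mul_neg]
    exact (eq_neg_of_add_eq_zero_left hZ).symm
  refine h.eq_zero_of_isCoprime hB.isCoprime_charpoly ?_ B.aeval_self_charpoly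
  rw [Polynomial.aeval_comp, map_neg, Polynomial.aeval_X, neg_neg, ← B.charpoly_transpose]
  exact Bᵀ.aeval_self_charpoly

theorem stmt1 {d : ℕ} (B : Matrix (Fin d) (Fin d) ℝ) (hB : B.PosStable) :
    (∀ X Y : Matrix (Fin d) (Fin d) ℝ,
      B * X + X * Bᵀ = B * Y + Y * Bᵀ → X = Y) ∧
    ∀ V : Matrix (Fin d) (Fin d) ℝ,
      ∃! Γ : Matrix (Fin d) (Fin d) ℝ, B * Γ + Γ * Bᵀ = V := by
  let L : Matrix (Fin d) (Fin d) ℝ →ₗ[ℝ] Matrix (Fin d) (Fin d) ℝ :=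
    LinearMap.mulLeft ℝ B + LinearMap.mulRight ℝ Bᵀ
  have hL : Function.Injective L :=
    (injective_iff_map_eq_zero L).2 fun _ hZ => hB.eq_zero_of_lyapunov hZ
  exact ⟨fun _ _ hXY => hL hXY,
    Function.Bijective.existsUnique (f := L) ⟨hL, LinearMap.injective_iff_surjective.1 hL⟩⟩
end

section
/- Let M be a real d×d matrix with singular value decomposition M = A·S·Bᵀ, where A and B are real d×d orthogonal matrices and S is a diagonal matrix with nonnegative diagonal entries. Then the orthogonal matrix A·Bᵀ is the closest orthogonal matrix to M in the Frobenius norm: for every real d×d orthogonal matrix Q, ‖M - A·Bᵀ‖_F ≤ ‖M - Q‖_F. -/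
open Matrix
open scoped Matrix

/-- The Frobenius norm of a real square matrix. -/
noncomputable def frobNorm {d : ℕ} (M : Matrix (Fin d) (Fin d) ℝ) : ℝ :=
  Real.sqrt (∑ i, ∑ j, (M i j) ^ 2)

theorem frobNorm_eq_sqrt_trace {d : ℕ} (X : Matrix (Fin d) (Fin d) ℝ) :
    frobNorm X = Real.sqrt (X * Xᵀ).trace := by
  simp [frobNorm, Matrix.trace, Matrix.mul_apply, sq]

theorem frobNorm_orthogonal_mul_mul {d : ℕ} {A B : Matrix (Fin d) (Fin d) ℝ}
    (hA : A * Aᵀ = 1) (hB : B * Bᵀ = 1) (X : Matrix (Fin d) (Fin d) ℝ) :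
    frobNorm (A * X * Bᵀ) = frobNorm X := by
  have hA' : Aᵀ * A = 1 := mul_eq_one_comm.mp hA
  have hB' : Bᵀ * B = 1 := mul_eq_one_comm.mp hB
  have h : A * X * Bᵀ * (A * X * Bᵀ)ᵀ = A * (X * Xᵀ * Aᵀ) := by
    calc _ = A * X * (Bᵀ * B) * (Xᵀ * Aᵀ) := by
          simp only [Matrix.transpose_mul, Matrix.transpose_transpose, Matrix.mul_assoc]
      _ = _ := by simp only [hB', Matrix.mul_one, Matrix.mul_assoc]
  rw [frobNorm_eq_sqrt_trace, frobNorm_eq_sqrt_trace, h, Matrix.trace_mul_comm,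
    Matrix.mul_assoc, hA', Matrix.mul_one]

theorem apply_le_one_of_mul_transpose_eq_one {d : ℕ} {W : Matrix (Fin d) (Fin d) ℝ}
    (hW : W * Wᵀ = 1) (i j : Fin d) : W i j ≤ 1 :=
  (le_abs_self _).trans
    (entry_norm_bound_of_unitary (𝕜 := ℝ) (Matrix.mem_unitaryGroup_iff.mpr hW) i j)

theorem frobNorm_diagonal_sub_one_le {d : ℕ} {S W : Matrix (Fin d) (Fin d) ℝ}
    (hSdiag : ∀ i j, i ≠ j → S i j = 0) (hSpos : ∀ i, 0 ≤ S i i) (hW : W * Wᵀ = 1) :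
    frobNorm (S - 1) ≤ frobNorm (S - W) := by
  have expand (V : Matrix (Fin d) (Fin d) ℝ) (hV : V * Vᵀ = 1) :
      ((S - V) * (S - V)ᵀ).trace =
        (S * Sᵀ).trace - 2 * ∑ i, S i i * V i i + (1 : Matrix (Fin d) (Fin d) ℝ).trace := by
    have hSV : (S * Vᵀ).trace = ∑ i, S i i * V i i := by
      simp only [Matrix.trace, Matrix.diag_apply, Matrix.mul_apply, Matrix.transpose_apply]
      refine Finset.sum_congr rfl fun i _ => ?_
      exact Finset.sum_eq_single i (fun j _ hj => by simp [hSdiag i j hj.symm]) (by simp)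
    have hVS : (V * Sᵀ).trace = (S * Vᵀ).trace := by
      rw [← Matrix.trace_transpose, Matrix.transpose_mul, Matrix.transpose_transpose]
    rw [Matrix.transpose_sub, Matrix.sub_mul, Matrix.mul_sub, Matrix.mul_sub, hV]
    simp only [Matrix.trace_sub, hVS, hSV]
    ring
  rw [frobNorm_eq_sqrt_trace, frobNorm_eq_sqrt_trace, expand 1 (by simp), expand W hW]
  have key : ∑ i, S i i * W i i ≤ ∑ i, S i i * (1 : Matrix (Fin d) (Fin d) ℝ) i i := by
    refine Finset.sum_le_sum fun i _ => mul_le_mul_of_nonneg_left ?_ (hSpos i)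
    simpa using apply_le_one_of_mul_transpose_eq_one hW i i
  exact Real.sqrt_le_sqrt (by linarith)

theorem stmt7 {d : ℕ} (M A S B : Matrix (Fin d) (Fin d) ℝ)
    (hA : A * Aᵀ = 1) (hB : B * Bᵀ = 1)
    (hSdiag : ∀ i j, i ≠ j → S i j = 0) (hSpos : ∀ i, 0 ≤ S i i)
    (hM : M = A * S * Bᵀ) :
    ∀ Q : Matrix (Fin d) (Fin d) ℝ, Q * Qᵀ = 1 →
      frobNorm (M - A * Bᵀ) ≤ frobNorm (M - Q) := by
  intro Q hQ
  have hA' : Aᵀ * A = 1 := mul_eq_one_comm.mp hA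
  have hW : (Aᵀ * Q * B) * (Aᵀ * Q * B)ᵀ = 1 := by
    calc _ = Aᵀ * (Q * (B * Bᵀ) * Qᵀ) * A := by
          simp only [Matrix.transpose_mul, Matrix.transpose_transpose, Matrix.mul_assoc]
      _ = 1 := by rw [hB, Matrix.mul_one, hQ, Matrix.mul_one, hA']
  have h1 : M - A * Bᵀ = A * (S - 1) * Bᵀ := by
    rw [hM, Matrix.mul_sub, Matrix.sub_mul, Matrix.mul_one]
  have h2 : M - Q = A * (S - Aᵀ * Q * B) * Bᵀ := by
    have hQ' : A * (Aᵀ * Q * B) * Bᵀ = Q := by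
      calc _ = (A * Aᵀ) * Q * (B * Bᵀ) := by simp only [Matrix.mul_assoc]
        _ = Q := by rw [hA, hB, Matrix.one_mul, Matrix.mul_one]
    rw [hM, Matrix.mul_sub, Matrix.sub_mul, hQ']
  rw [h1, h2, frobNorm_orthogonal_mul_mul hA hB, frobNorm_orthogonal_mul_mul hA hB]
  exact frobNorm_diagonal_sub_one_le hSdiag hSpos hW
end

section
/- In the kernel setup, the kernel κ satisfies detailed balance with respect to μ: for all measurable sets A and B, ∫_A κ(x)(B) μ(dx) = ∫_B κ(x)(A) μ(dx). Consequently μ is a stationary distribution for κ, i.e., ∫ κ(x)(·) μ(dx) = μ. (This is the correctness of the alternative MCMC algorithm for exact diffusion bridge simulation: a chain that, from state x, resamples from the approximate-bridge law ν with probability π(x) and otherwise stays at x has the exact bridge law μ as stationary distribution, where ν has density π/c with respect to μ.) -/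
open MeasureTheory ProbabilityTheory
open scoped ENNReal

/-- Integrating a mixture of a fixed measure `ν` and the Dirac measure at the current point. -/
lemma setLIntegral_smul_add_smul_dirac_apply {E : Type*} [MeasurableSpace E]
    (μ ν : Measure E) {p q : E → ℝ≥0∞} (hp : Measurable p) {A B : Set E} (hB : MeasurableSet B) :
    ∫⁻ x in A, (p x • ν + q x • Measure.dirac x) B ∂μ =
      (∫⁻ x in A, p x ∂μ) * ν B + ∫⁻ x in B ∩ A, q x ∂μ := by
  have h : ∀ x, (p x • ν + q x • Measure.dirac x) B = p x * ν B + B.indicator q x := by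
    intro x
    by_cases hx : x ∈ B <;> simp [Measure.dirac_apply' x hB, hx]
  simp_rw [h]
  rw [lintegral_add_left (hp.mul_const _), lintegral_mul_const _ hp, setLIntegral_indicator hB]

theorem stmt8 {E : Type*} [MeasurableSpace E]
    (μ ν : Measure E) [IsProbabilityMeasure μ] [IsProbabilityMeasure ν]
    (π : E → ℝ≥0∞) (hπmeas : Measurable π) (hπle : ∀ x, π x ≤ 1)
    (c : ℝ≥0∞) (hc : c = ∫⁻ x, π x ∂μ) (hcpos : 0 < c)
    (hν : ν = c⁻¹ • μ.withDensity π)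
    (κ : Kernel E E)
    (hκ : ∀ x, κ x = π x • ν + (1 - π x) • Measure.dirac x) :
    (∀ A B : Set E, MeasurableSet A → MeasurableSet B →
      ∫⁻ x in A, κ x B ∂μ = ∫⁻ x in B, κ x A ∂μ) ∧
    μ.bind (fun x => κ x) = μ := by
  have νapply : ∀ S, MeasurableSet S → ν S = c⁻¹ * ∫⁻ x in S, π x ∂μ := fun S hS => by
    rw [hν, Measure.smul_apply, withDensity_apply _ hS, smul_eq_mul]
  have reversible : ∀ A B : Set E, MeasurableSet A → MeasurableSet B →
      ∫⁻ x in A, κ x B ∂μ = ∫⁻ x in B, κ x A ∂μ := by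
    intro A B hA hB
    simp_rw [hκ]
    rw [setLIntegral_smul_add_smul_dirac_apply μ ν hπmeas hB,
      setLIntegral_smul_add_smul_dirac_apply μ ν hπmeas hA,
      νapply A hA, νapply B hB, Set.inter_comm]
    ring
  have : IsMarkovKernel κ := ⟨fun x => ⟨by simp [hκ, add_tsub_cancel_of_le (hπle x)]⟩⟩
  have hrev : Kernel.IsReversible κ μ := fun A B hA hB => reversible A B hA hB
  exact ⟨reversible, hrev.invariant⟩
end

section
/- In the kernel setup, assume additionally that all singletons of E are measurable, that ν({y}) = 0 for every y ∈ E, and that there is ε ∈ (0,1] with π(x) ≥ ε for all x ∈ E. Then for every x ∈ E and every natural number i, the i-fold composition κ^i of the kernel κ satisfies κ^i(x)({x}) ≤ (1-ε)^i. (This is the exponential mixing bound P(X^{(i)} = X^{(0)}) ≤ (1-ε)^i for the alternative MCMC algorithm.) -/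
open MeasureTheory ProbabilityTheory
open scoped ENNReal

/-- The `i`-fold composition of a kernel with itself. -/
noncomputable def kernelIter {E : Type*} [MeasurableSpace E] (κ : Kernel E E) :
    ℕ → Kernel E E
  | 0 => Kernel.id
  | n + 1 => κ ∘ₖ kernelIter κ n

theorem stmt9 {E : Type*} [MeasurableSpace E] [MeasurableSingletonClass E]
    (μ ν : Measure E) [IsProbabilityMeasure μ] [IsProbabilityMeasure ν]
    (π : E → ℝ≥0∞) (hπmeas : Measurable π) (hπle : ∀ x, π x ≤ 1)
    (c : ℝ≥0∞) (hc : c = ∫⁻ x, π x ∂μ) (hcpos : 0 < c)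
    (hν : ν = c⁻¹ • μ.withDensity π)
    (κ : Kernel E E) [IsMarkovKernel κ]
    (hκ : ∀ x, κ x = π x • ν + (1 - π x) • Measure.dirac x)
    (hνsing : ∀ y : E, ν {y} = 0)
    (ε : ℝ≥0∞) (hε : 0 < ε) (hε1 : ε ≤ 1) (hπε : ∀ x, ε ≤ π x) :
    ∀ (x : E) (i : ℕ), (kernelIter κ i) x {x} ≤ (1 - ε) ^ i := by
  have hstep : ∀ x y : E, κ y {x} ≤ ({x} : Set E).indicator (fun _ => 1 - ε) y := by
    intro x y
    by_cases h : y = x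
    · subst h
      simpa [hκ, hνsing] using tsub_le_tsub_left (hπε y) 1
    · simp [hκ, hνsing, h]
  intro x i
  induction i with
  | zero => simp [kernelIter, Kernel.id_apply]
  | succ n ih =>
    have hx : MeasurableSet ({x} : Set E) := measurableSet_singleton x
    calc (kernelIter κ (n + 1)) x {x}
        = ∫⁻ y, κ y {x} ∂(kernelIter κ n x) := Kernel.comp_apply' _ _ _ hx
      _ ≤ ∫⁻ y, ({x} : Set E).indicator (fun _ => 1 - ε) y ∂(kernelIter κ n x) :=
          lintegral_mono (hstep x)
      _ = (1 - ε) * kernelIter κ n x {x} := lintegral_indicator_const hx _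
      _ ≤ (1 - ε) * (1 - ε) ^ n := by gcongr
      _ = (1 - ε) ^ (n + 1) := (pow_succ' _ _).symm
end
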